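/- Let n ≥ 2. For every x ∈ ℙ^{n-1}(ℝ) and every τ ∈ ℝ with |τ| ≥ 1 there exists a point y ∈ ℙ^{n-1}(ℚ) such that H_e(y) ≤ c(n)·|τ|^{n-1} and δ_∞(x, y) ≤ c(n)·(|τ| · H_e(y))^{-1}, where c(n) = 2·π^{-1/2}·Γ(n/2 + 1)^{1/n}. -/

import Mathlib

open MeasureTheory

noncomputable section

/-- The p-adic projective distance (at vector level): the sup-norm of the wedge product
divided by the product of sup norms.  Invariant under scaling, it descends to
projective space. -/
def padicDelta (p : ℕ) [Fact p.Prime] {n : ℕ} (x y : Fin n → ℚ_[p]) : ℝ :=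
  (⨆ ij : Fin n × Fin n, ‖x ij.1 * y ij.2 - x ij.2 * y ij.1‖) / (‖x‖ * ‖y‖)

instance (p : ℕ) [Fact p.Prime] (n : ℕ) : MeasurableSpace (Fin n → ℚ_[p]) := borel _
instance (p : ℕ) [Fact p.Prime] (n : ℕ) : BorelSpace (Fin n → ℚ_[p]) := ⟨rfl⟩

/-- `ℤ_p^n` as a positive compact subset of `ℚ_p^n`. -/
def padicUnitPC (p : ℕ) [Fact p.Prime] (n : ℕ) :
    TopologicalSpace.PositiveCompacts (Fin n → ℚ_[p]) where
  carrier := {x | ∀ i, ‖x i‖ ≤ 1}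
  isCompact' := by
    have : {x : Fin n → ℚ_[p] | ∀ i, ‖x i‖ ≤ 1} = Set.univ.pi fun _ => Metric.closedBall 0 1 := by
      ext x; simp [Metric.mem_closedBall, dist_eq_norm]
    rw [this]
    exact isCompact_univ_pi fun i => isCompact_closedBall 0 1
  interior_nonempty' := by
    refine ⟨0, ?_⟩
    rw [mem_interior]
    refine ⟨Metric.ball 0 1, fun x hx i => ?_, Metric.isOpen_ball, by simp⟩
    have hx' : ‖x‖ < 1 := by simpa [dist_eq_norm] using hx
    exact le_of_lt (lt_of_le_of_lt (norm_le_pi_norm x i) hx')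

/-- Haar measure on `ℚ_p^n`, normalized so that `ℤ_p^n` has measure one. -/
def padicHaar (p : ℕ) [Fact p.Prime] (n : ℕ) : Measure (Fin n → ℚ_[p]) :=
  Measure.addHaarMeasure (padicUnitPC p n)

/-- The natural probability measure `μ_p` on `ℙ^{n-1}(ℚ_p)`:
`μ_p(M) = β(φ⁻¹(M) ∩ ℤ_p^n)`. -/
def muP (p : ℕ) [Fact p.Prime] (n : ℕ)
    (M : Set (Projectivization ℚ_[p] (Fin n → ℚ_[p]))) : ENNReal :=
  padicHaar p n {x | (∀ i, ‖x i‖ ≤ 1) ∧ ∃ hx : x ≠ 0, Projectivization.mk ℚ_[p] x hx ∈ M}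

/-- A visible (primitive) integer vector: the gcd of its coordinates is 1. -/
def IsPrim {n : ℕ} (v : Fin n → ℤ) : Prop := Finset.univ.gcd v = 1

/-- The sup-norm height of an integer vector. -/
def Hsup {n : ℕ} (v : Fin n → ℤ) : ℕ := Finset.univ.sup fun i => (v i).natAbs

/-- Embedding of an integer vector into `ℚ_p^n`. -/
def intPadic (p : ℕ) [Fact p.Prime] {n : ℕ} (v : Fin n → ℤ) : Fin n → ℚ_[p] :=
  fun i => ((v i : ℤ) : ℚ_[p])

/-- Embedding of an integer vector into `ℚ^n`. -/
def intRat {n : ℕ} (v : Fin n → ℤ) : Fin n → ℚ := fun i => ((v i : ℤ) : ℚ)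

/-- The set `W_p(ψ, ℚ, n)` of points of `ℙ^{n-1}(ℚ_p)` admitting infinitely many
rational approximations `y` with `δ_p(x,y) ≤ ψ(H(y))`. -/
def Wp (p : ℕ) [Fact p.Prime] (n : ℕ) (ψ : ℕ → ℝ) :
    Set (Projectivization ℚ_[p] (Fin n → ℚ_[p])) :=
  {x | {y : Projectivization ℚ (Fin n → ℚ) | ∃ v : Fin n → ℤ, IsPrim v ∧
      (∃ hv : intRat v ≠ 0, y = Projectivization.mk ℚ (intRat v) hv) ∧
      padicDelta p x.rep (intPadic p v) ≤ ψ (Hsup v)}.Infinite}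

/-- Closed ball for the projective metric, centered at the class of the vector `y`. -/
def Bdelta (p : ℕ) [Fact p.Prime] {n : ℕ} (y : Fin n → ℚ_[p]) (r : ℝ) :
    Set (Projectivization ℚ_[p] (Fin n → ℚ_[p])) :=
  {z | padicDelta p z.rep y ≤ r}

/-- The Euclidean norm of a vector in `ℝ^n`. -/
noncomputable def eNorm {n : ℕ} (x : Fin n → ℝ) : ℝ := Real.sqrt (∑ i, (x i) ^ 2)

/-- Norm of the wedge product of two vectors in `ℝ^n`:
`‖x ∧ y‖² = Σ_{i<j} (x_i y_j − x_j y_i)²`. -/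
noncomputable def wedgeNorm {n : ℕ} (x y : Fin n → ℝ) : ℝ :=
  Real.sqrt (∑ ij ∈ Finset.univ.filter (fun ij : Fin n × Fin n => ij.1 < ij.2),
    (x ij.1 * y ij.2 - x ij.2 * y ij.1) ^ 2)

/-- The projective distance at the infinite place (vector level):
`δ_∞(x,y) = ‖x ∧ y‖ / (‖x‖‖y‖)`. Invariant under scaling, it descends to `ℙ^{n-1}(ℝ)`. -/
noncomputable def deltaInf {n : ℕ} (x y : Fin n → ℝ) : ℝ :=
  wedgeNorm x y / (eNorm x * eNorm y)

/-- Embedding of an integer vector into `ℝ^n`. -/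
noncomputable def intReal {n : ℕ} (v : Fin n → ℤ) : Fin n → ℝ := fun i => ((v i : ℤ) : ℝ)

/-- The natural probability measure `μ_∞` on `ℙ^{n-1}(ℝ)`:
`μ_∞(M) = λ(φ⁻¹(M) ∩ B(0,1)) / λ(B(0,1))`. -/
noncomputable def muInf (n : ℕ) (M : Set (Projectivization ℝ (Fin n → ℝ))) : ENNReal :=
  MeasureTheory.volume {x : Fin n → ℝ | eNorm x ≤ 1 ∧
      ∃ hx : x ≠ 0, Projectivization.mk ℝ x hx ∈ M} /
    MeasureTheory.volume {x : Fin n → ℝ | eNorm x ≤ 1}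

/-- The set `W_∞(ψ, ℚ, n)` of points of `ℙ^{n-1}(ℝ)` admitting infinitely many
rational approximations `y` with `δ_∞(x,y) ≤ ψ(H(y))`. -/
noncomputable def Winf (n : ℕ) (ψ : ℕ → ℝ) : Set (Projectivization ℝ (Fin n → ℝ)) :=
  {x | {y : Projectivization ℚ (Fin n → ℚ) | ∃ v : Fin n → ℤ, IsPrim v ∧
      (∃ hv : intRat v ≠ 0, y = Projectivization.mk ℚ (intRat v) hv) ∧
      deltaInf x.rep (intReal v) ≤ ψ (Hsup v)}.Infinite}

/-- The Choi–Vaaler constant `c(n) = 2·π^{-1/2}·Γ(n/2+1)^{1/n}` for `k = ℚ`. -/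
noncomputable def cCV (n : ℕ) : ℝ :=
  2 * Real.pi ^ (-(1/2 : ℝ)) * Real.Gamma ((n : ℝ) / 2 + 1) ^ ((1 : ℝ) / n)

/-- The Euclidean height of a primitive integer vector. -/
noncomputable def He {n : ℕ} (v : Fin n → ℤ) : ℝ := eNorm (intReal v)

end
section EuclideanForms

variable {n : ℕ}

lemma eNorm_nonneg (x : Fin n → ℝ) : 0 ≤ eNorm x := Real.sqrt_nonneg _

lemma wedgeNorm_nonneg (x y : Fin n → ℝ) : 0 ≤ wedgeNorm x y := Real.sqrt_nonneg _

lemma eNorm_sq (x : Fin n → ℝ) : eNorm x ^ 2 = x ⬝ᵥ x := by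
  rw [eNorm, Real.sq_sqrt (Finset.sum_nonneg fun i _ => sq_nonneg _)]
  simp only [dotProduct, sq]

lemma eNorm_eq_norm_toLp (x : Fin n → ℝ) : eNorm x = ‖WithLp.toLp 2 x‖ := by
  simp [eNorm, EuclideanSpace.norm_eq]

lemma eNorm_pos {x : Fin n → ℝ} (hx : x ≠ 0) : 0 < eNorm x := by
  rw [eNorm_eq_norm_toLp, norm_pos_iff]
  simpa using hx

lemma eNorm_smul (a : ℝ) (x : Fin n → ℝ) : eNorm (a • x) = |a| * eNorm x := by
  rw [eNorm_eq_norm_toLp, eNorm_eq_norm_toLp, WithLp.toLp_smul, norm_smul, Real.norm_eq_abs]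

/-- Lagrange's identity. -/
lemma wedgeNorm_sq (x y : Fin n → ℝ) :
    wedgeNorm x y ^ 2 = (x ⬝ᵥ x) * (y ⬝ᵥ y) - (x ⬝ᵥ y) ^ 2 := by
  rw [wedgeNorm, Real.sq_sqrt (Finset.sum_nonneg fun i _ => sq_nonneg _)]
  set f : Fin n → Fin n → ℝ := fun i j => (x i * y j - x j * y i) ^ 2 with hf
  have hsplit : ∑ i, ∑ j, f i j =
      (∑ i, ∑ j, if i < j then f i j else 0) + ∑ i, ∑ j, if j < i then f i j else 0 := by
    simp only [← Finset.sum_add_distrib]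
    refine Finset.sum_congr rfl fun i _ => Finset.sum_congr rfl fun j _ => ?_
    rcases lt_trichotomy i j with h | rfl | h
    · simp [h, h.not_gt]
    · simp [hf]
    · simp [h, h.not_gt]
  have hswap : (∑ i, ∑ j, if j < i then f i j else 0) =
      ∑ i, ∑ j, if i < j then f i j else 0 := by
    rw [Finset.sum_comm]
    refine Finset.sum_congr rfl fun i _ => Finset.sum_congr rfl fun j _ => ?_
    congr 1
    simp only [hf]
    ring
  have hexp : ∑ i, ∑ j, f i j = 2 * ((x ⬝ᵥ x) * (y ⬝ᵥ y) - (x ⬝ᵥ y) ^ 2) := by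
    have hterm : ∀ i j, f i j =
        (x i * x i) * (y j * y j) + (y i * y i) * (x j * x j) -
          2 * ((x i * y i) * (x j * y j)) := fun i j => by
      simp only [hf]
      ring
    simp only [hterm, Finset.sum_add_distrib, Finset.sum_sub_distrib, ← Finset.mul_sum,
      ← Finset.sum_mul]
    simp only [dotProduct]
    ring
  rw [Finset.sum_filter, Fintype.sum_prod_type]
  linarith

lemma wedgeNorm_smul_right (a : ℝ) (x y : Fin n → ℝ) :
    wedgeNorm x (a • y) = |a| * wedgeNorm x y := by
  rw [← sq_eq_sq₀ (wedgeNorm_nonneg _ _) (mul_nonneg (abs_nonneg _) (wedgeNorm_nonneg _ _)),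
    mul_pow, sq_abs, wedgeNorm_sq, wedgeNorm_sq]
  simp only [dotProduct_smul, smul_dotProduct, smul_eq_mul]
  ring

end EuclideanForms

section IntegerVectors

variable {n : ℕ}

lemma exists_isPrim_smul {v : Fin n → ℤ} (hv : v ≠ 0) :
    ∃ (d : ℤ) (w : Fin n → ℤ), d ≠ 0 ∧ IsPrim w ∧ v = d • w := by
  obtain ⟨i, hi⟩ := Function.ne_iff.mp hv
  obtain ⟨w, hw, hgcd⟩ := Finset.extract_gcd v ⟨i, Finset.mem_univ i⟩
  refine ⟨Finset.univ.gcd v, w, ?_, hgcd, funext fun j => hw j (Finset.mem_univ j)⟩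
  exact fun h => hi (Finset.gcd_eq_zero_iff.mp h i (Finset.mem_univ i))

lemma intReal_smul (d : ℤ) (v : Fin n → ℤ) : intReal (d • v) = (d : ℝ) • intReal v := by
  ext i
  simp [intReal]

lemma IsPrim.intReal_ne_zero {v : Fin n → ℤ} (hv : IsPrim v) : intReal v ≠ 0 := by
  intro h
  have hzero : ∀ i ∈ Finset.univ, v i = 0 := fun i _ => by
    simpa [intReal] using congrFun h i
  rw [IsPrim, Finset.gcd_eq_zero_iff.mpr hzero] at hv
  exact zero_ne_one hv

end IntegerVectors

section Minkowski

variable {n : ℕ}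

lemma cCV_pos (n : ℕ) : 0 < cCV n := by
  have : 0 < Real.Gamma ((n : ℝ) / 2 + 1) := Real.Gamma_pos_of_pos (by positivity)
  rw [cCV]
  positivity

lemma cCV_pow (hn : n ≠ 0) :
    cCV n ^ n * (√Real.pi ^ n / Real.Gamma ((n : ℝ) / 2 + 1)) = 2 ^ n := by
  have hΓ : 0 < Real.Gamma ((n : ℝ) / 2 + 1) := Real.Gamma_pos_of_pos (by positivity)
  have hπ : 0 < √Real.pi := Real.sqrt_pos.mpr Real.pi_pos
  have hroot : (Real.Gamma ((n : ℝ) / 2 + 1) ^ ((1 : ℝ) / n)) ^ n =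
      Real.Gamma ((n : ℝ) / 2 + 1) := by
    rw [one_div, Real.rpow_inv_natCast_pow hΓ.le hn]
  rw [cCV, Real.rpow_neg Real.pi_pos.le, ← Real.sqrt_eq_rpow, mul_pow, mul_pow, hroot, inv_pow]
  field_simp

/-- The ball of radius `cCV n` has volume `2 ^ n`. -/
lemma volume_closedBall_cCV (hn : n ≠ 0) :
    volume (Metric.closedBall (0 : EuclideanSpace ℝ (Fin n)) (cCV n)) = 2 ^ n := by
  have : Nonempty (Fin n) := Fin.pos_iff_nonempty.mp (Nat.pos_of_ne_zero hn)
  rw [EuclideanSpace.volume_closedBall, Fintype.card_fin,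
    ← ENNReal.ofReal_pow (cCV_pos n).le, ← ENNReal.ofReal_mul (pow_nonneg (cCV_pos n).le _),
    cCV_pow hn, ENNReal.ofReal_pow zero_le_two]
  simp

/-- Minkowski's theorem for the ellipsoid `‖A y‖ ≤ cCV n` with `det A = 1`. -/
lemma exists_int_eNorm_mulVec_le (hn : n ≠ 0) (A : Matrix (Fin n) (Fin n) ℝ)
    (hA : A.det = 1) : ∃ v : Fin n → ℤ, v ≠ 0 ∧ eNorm (A.mulVec (intReal v)) ≤ cCV n := by
  have : Nonempty (Fin n) := Fin.pos_iff_nonempty.mp (Nat.pos_of_ne_zero hn)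
  have hdet : LinearMap.det (Matrix.toLin' A) = 1 := by rw [LinearMap.det_toLin', hA]
  let f : (Fin n → ℝ) →ₗ[ℝ] EuclideanSpace ℝ (Fin n) :=
    (WithLp.linearEquiv 2 ℝ (Fin n → ℝ)).symm.toLinearMap ∘ₗ Matrix.toLin' A
  have hf : ∀ y, f y = WithLp.toLp 2 (A.mulVec y) := fun y => rfl
  have hinj : LinearMap.ker f = ⊥ := by
    rw [LinearMap.ker_eq_bot]
    refine (WithLp.linearEquiv 2 ℝ (Fin n → ℝ)).symm.injective.comp ?_
    exact (LinearMap.equivOfDetNeZero (Matrix.toLin' A) (by simp [hdet])).injective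
  set S : Set (Fin n → ℝ) := f ⁻¹' Metric.closedBall 0 (cCV n) with hS
  have hvol : volume S = 2 ^ n := by
    have hpre : S = Matrix.toLin' A ⁻¹'
      (WithLp.toLp 2 ⁻¹' Metric.closedBall (0 : EuclideanSpace ℝ (Fin n)) (cCV n)) := rfl
    rw [hpre, Measure.addHaar_preimage_linearMap _ (by simp [hdet]), hdet,
      (PiLp.volume_preserving_toLp (Fin n)).measure_preimage
        Metric.isClosed_closedBall.measurableSet.nullMeasurableSet, volume_closedBall_cCV hn]
    simp
  have : Countable (Submodule.span ℤ (Set.range (Pi.basisFun ℝ (Fin n)))).toAddSubgroup :=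
    inferInstanceAs (Countable (Submodule.span ℤ (Set.range (Pi.basisFun ℝ (Fin n)))))
  have : DiscreteTopology (Submodule.span ℤ (Set.range (Pi.basisFun ℝ (Fin n)))).toAddSubgroup :=
    inferInstanceAs (DiscreteTopology (Submodule.span ℤ (Set.range (Pi.basisFun ℝ (Fin n)))))
  obtain ⟨⟨y, hy⟩, hy0, hyS⟩ :=
    exists_ne_zero_mem_lattice_of_measure_mul_two_pow_le_measure
      (ZSpan.isAddFundamentalDomain' (Pi.basisFun ℝ (Fin n)) volume) (s := S)
      (fun z hz => by simpa [hS] using hz)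
      ((convex_closedBall 0 (cCV n)).linear_preimage f)
      ((f.isClosedEmbedding_of_injective hinj).isCompact_preimage (isCompact_closedBall 0 _))
      (by
        rw [hvol, ZSpan.fundamentalDomain_pi_basisFun, Real.volume_pi_Ico]
        simp)
  have hyint : ∀ i, ∃ m : ℤ, (m : ℝ) = y i := by
    simpa using (Module.Basis.mem_span_iff_repr_mem ℤ (Pi.basisFun ℝ (Fin n)) y).mp hy
  choose v hv using hyint
  have hvy : intReal v = y := funext hv
  refine ⟨v, ?_, ?_⟩
  · rintro rfl
    exact hy0 (Subtype.ext (funext fun i => by simp [← hv i]))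
  · rw [hvy, eNorm_eq_norm_toLp, ← hf]
    simpa [hS] using hyS

end Minkowski

section Ellipsoid

variable {n : ℕ}

/-- The linear map scaling the line through `w` by `α` and its orthogonal complement by `β`. -/
noncomputable def axisScaling (w : Fin n → ℝ) (α β : ℝ) : Matrix (Fin n) (Fin n) ℝ :=
  β • (1 + Matrix.replicateCol Unit (((α / β - 1) / (w ⬝ᵥ w)) • w) * Matrix.replicateRow Unit w)

lemma det_axisScaling (hn : n ≠ 0) {w : Fin n → ℝ} (hw : w ≠ 0) (α : ℝ) {β : ℝ} (hβ : β ≠ 0) :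
    (axisScaling w α β).det = α * β ^ (n - 1) := by
  have hww : w ⬝ᵥ w ≠ 0 := dotProduct_self_eq_zero.not.mpr hw
  rw [axisScaling, Matrix.det_smul, Matrix.det_one_add_replicateCol_mul_replicateRow,
    dotProduct_smul, Fintype.card_fin, smul_eq_mul, div_mul_cancel₀ _ hww]
  obtain ⟨m, rfl⟩ := Nat.exists_eq_succ_of_ne_zero hn
  rw [Nat.succ_sub_one, pow_succ]
  field_simp
  ring

lemma axisScaling_mulVec (w y : Fin n → ℝ) (α β : ℝ) :
    (axisScaling w α β).mulVec y =
      β • (y + ((α / β - 1) / (w ⬝ᵥ w) * (w ⬝ᵥ y)) • w) := by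
  rw [axisScaling, Matrix.smul_mulVec, Matrix.add_mulVec, Matrix.one_mulVec,
    ← Matrix.mulVec_mulVec]
  congr 2
  ext i
  simp [Matrix.mulVec, dotProduct, Matrix.replicateCol, Matrix.replicateRow]
  ring

lemma eNorm_axisScaling_mulVec {w : Fin n → ℝ} (hw : w ≠ 0) (y : Fin n → ℝ) (α : ℝ) {β : ℝ}
    (hβ : β ≠ 0) :
    eNorm w ^ 2 * eNorm ((axisScaling w α β).mulVec y) ^ 2 =
      β ^ 2 * wedgeNorm w y ^ 2 + α ^ 2 * (w ⬝ᵥ y) ^ 2 := by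
  have hww : w ⬝ᵥ w ≠ 0 := dotProduct_self_eq_zero.not.mpr hw
  rw [axisScaling_mulVec, wedgeNorm_sq, eNorm_sq, eNorm_sq]
  simp only [dotProduct_smul, smul_dotProduct, dotProduct_add, add_dotProduct, smul_eq_mul,
    dotProduct_comm y w]
  field_simp
  ring

lemma exists_int_eNorm_le_wedgeNorm_le (hn : n ≠ 0) {w : Fin n → ℝ} (hw : w ≠ 0) {α β : ℝ}
    (hα : 0 < α) (hαβ : α ≤ β) (hdet : α * β ^ (n - 1) = 1) :
    ∃ v : Fin n → ℤ, v ≠ 0 ∧ α * eNorm (intReal v) ≤ cCV n ∧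
      β * wedgeNorm w (intReal v) ≤ cCV n * eNorm w := by
  have hβ : 0 < β := hα.trans_le hαβ
  obtain ⟨v, hv0, hv⟩ := exists_int_eNorm_mulVec_le hn (axisScaling w α β)
    (by rw [det_axisScaling hn hw α hβ.ne', hdet])
  have hN := eNorm_pos hw
  have hc := cCV_pos n
  have hform := eNorm_axisScaling_mulVec hw (intReal v) α hβ.ne'
  have hlag := wedgeNorm_sq w (intReal v)
  rw [← eNorm_sq, ← eNorm_sq] at hlag
  have hle : β ^ 2 * wedgeNorm w (intReal v) ^ 2 + α ^ 2 * (w ⬝ᵥ intReal v) ^ 2 ≤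
      eNorm w ^ 2 * cCV n ^ 2 := by
    rw [← hform]
    gcongr
    exact eNorm_nonneg _
  refine ⟨v, hv0, ?_, ?_⟩
  · refine le_of_mul_le_mul_left (abs_le_of_sq_le_sq' ?_ (by positivity)).2 hN
    calc (eNorm w * (α * eNorm (intReal v))) ^ 2
        = α ^ 2 * wedgeNorm w (intReal v) ^ 2 + α ^ 2 * (w ⬝ᵥ intReal v) ^ 2 := by
          rw [hlag]
          ring
      _ ≤ β ^ 2 * wedgeNorm w (intReal v) ^ 2 + α ^ 2 * (w ⬝ᵥ intReal v) ^ 2 := by gcongr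
      _ ≤ (eNorm w * cCV n) ^ 2 := by rwa [mul_pow]
  · refine (abs_le_of_sq_le_sq' ?_ (by positivity)).2
    nlinarith [sq_nonneg (α * (w ⬝ᵥ intReal v))]

end Ellipsoid

/-- Choi–Vaaler projective Dirichlet theorem for `ℚ` at the infinite place. -/
theorem projective_dirichlet_real (n : ℕ) (hn : 2 ≤ n)
    (x : Projectivization ℝ (Fin n → ℝ)) (τ : ℝ) (hτ : 1 ≤ |τ|) :
    ∃ v : Fin n → ℤ, IsPrim v ∧
      He v ≤ cCV n * |τ| ^ (n - 1) ∧
      deltaInf x.rep (intReal v) ≤ cCV n * (|τ| * He v)⁻¹ := by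
  have hT : 0 < |τ| := one_pos.trans_le hτ
  obtain ⟨v, hv0, hnorm, hwedge⟩ := exists_int_eNorm_le_wedgeNorm_le (by omega : n ≠ 0)
    x.rep_nonzero (α := (|τ| ^ (n - 1))⁻¹) (β := |τ|) (by positivity)
    ((inv_le_one_of_one_le₀ (one_le_pow₀ hτ)).trans hτ) (inv_mul_cancel₀ (by positivity))
  obtain ⟨d, v, hd, hprim, rfl⟩ := exists_isPrim_smul hv0
  have hd1 : 1 ≤ |(d : ℝ)| := by exact_mod_cast Int.one_le_abs hd
  rw [intReal_smul, eNorm_smul, inv_mul_le_iff₀ (by positivity), mul_comm (|τ| ^ _)] at hnorm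
  rw [intReal_smul, wedgeNorm_smul_right] at hwedge
  have hx := eNorm_pos x.rep_nonzero
  have hv := eNorm_pos hprim.intReal_ne_zero
  refine ⟨v, hprim, (le_mul_of_one_le_left hv.le hd1).trans hnorm, ?_⟩
  have hle : |τ| * wedgeNorm x.rep (intReal v) ≤ cCV n * eNorm x.rep :=
    (mul_le_mul_of_nonneg_left (le_mul_of_one_le_left (wedgeNorm_nonneg _ _) hd1) hT.le).trans
      hwedge
  rw [deltaInf, He, ← div_eq_mul_inv, div_le_div_iff₀ (by positivity) (by positivity)]
  calc wedgeNorm x.rep (intReal v) * (|τ| * eNorm (intReal v))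
      = |τ| * wedgeNorm x.rep (intReal v) * eNorm (intReal v) := by ring
    _ ≤ cCV n * eNorm x.rep * eNorm (intReal v) := by gcongr
    _ = cCV n * (eNorm x.rep * eNorm (intReal v)) := by ring
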